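/- (Consistent explanations in small regions.) For every c > 0 there exists a constant K > 0, depending only on c, with the following property. Let r = (√(2c+1) − 1)/2 and use the stable weight α_c. For every n ≥ 1, every nonempty finite dataset X ⊆ ℝ^n, every label function f with |f(x)| ≤ 1 for all x, all points z, v ∈ ℝ^n, and every d with 0 ≤ d ≤ r and ‖v − z‖ ≤ d: if φ_z minimizes φ ↦ L(φ, z, X, f) over the closed unit ball and φ_v minimizes φ ↦ L(φ, v, X, f) over the closed unit ball, then L(φ_z, v, X, f) − L(φ_v, v, X, f) ≤ K·d. -/

import Mathlib

open scoped RealInnerProductSpace BigOperators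

/-- `r = (√(2c+1) − 1)/2`, so that `2r(1+r) = c`. -/
noncomputable def stableRadius (c : ℝ) : ℝ := (Real.sqrt (2 * c + 1) - 1) / 2

/-- The stable weight function `α_c`: equal to `1` for `t ≤ r` and to `c/(2t(1+t))`
for `t > r`, where `r = (√(2c+1) − 1)/2`. -/
noncomputable def stableWeight (c : ℝ) (t : ℝ) : ℝ :=
  if t ≤ stableRadius c then 1 else c / (2 * t * (1 + t))

/-- The weighted local loss at query point `w`, using the stable weight `α_c`:
`L(φ, w, X, f) = (1/m) · Σ_{x ∈ X} α_c(‖x − w‖) · (⟪φ, x − w⟫ − f(x))²` with `m = |X|`. -/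
noncomputable def stableLoss {n : ℕ} (c : ℝ) (φ w : EuclideanSpace ℝ (Fin n))
    (X : Finset (EuclideanSpace ℝ (Fin n))) (f : EuclideanSpace ℝ (Fin n) → ℝ) : ℝ :=
  (1 / (X.card : ℝ)) * ∑ x ∈ X, stableWeight c ‖x - w‖ * (⟪φ, x - w⟫ - f x) ^ 2

theorem stableRadius_pos {c : ℝ} (hc : 0 < c) : 0 < stableRadius c := by
  have h : (1 : ℝ) < Real.sqrt (2 * c + 1) := by
    rw [Real.lt_sqrt zero_le_one]
    linarith
  unfold stableRadius
  linarith

theorem two_mul_stableRadius_mul {c : ℝ} (hc : 0 < c) :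
    2 * stableRadius c * (1 + stableRadius c) = c := by
  have h : Real.sqrt (2 * c + 1) ^ 2 = 2 * c + 1 := Real.sq_sqrt (by linarith)
  unfold stableRadius
  linear_combination h / 2

theorem stableWeight_eq {c : ℝ} (hc : 0 < c) (t : ℝ) :
    stableWeight c t = stableRadius c * (1 + stableRadius c) /
      (max t (stableRadius c) * (1 + max t (stableRadius c))) := by
  have hr := stableRadius_pos hc
  have hrc := two_mul_stableRadius_mul hc
  unfold stableWeight
  split_ifs with h
  · rw [max_eq_right h, div_self (by positivity)]
  · have ht : 0 < t := by linarith
    rw [max_eq_left (by linarith)]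
    nth_rewrite 1 [← hrc]
    field_simp

/-- Stability of a single weighted squared residual: `M`, `N` are the distances truncated below
at `r`, and `p`, `q` are the residuals. -/
theorem weighted_sq_sub_le {r M N p q d : ℝ} (hr : 0 < r) (hM : r ≤ M) (hN : r ≤ N)
    (hd : 0 ≤ d) (hdr : d ≤ r) (hNM : |N - M| ≤ d) (hpq : |p - q| ≤ d)
    (hp : |p| ≤ 1 + M) (hq : |q| ≤ 1 + N) :
    r * (1 + r) / (M * (1 + M)) * p ^ 2 - r * (1 + r) / (N * (1 + N)) * q ^ 2 ≤
      (3 * (1 + r) + 3 * (1 + r) ^ 2 / r) * d := by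
  have hM0 : 0 < M := by linarith
  have hN0 : 0 < N := by linarith
  have hNM' : N - M ≤ d := (abs_le.mp hNM).2
  have residual : r * (1 + r) / (M * (1 + M)) * (p ^ 2 - q ^ 2) ≤ 3 * (1 + r) * d := by
    have h : p ^ 2 - q ^ 2 ≤ d * (2 + 3 * M) := by
      calc p ^ 2 - q ^ 2 = (p - q) * (p + q) := by ring
        _ ≤ |p - q| * |p + q| := by rw [← abs_mul]; exact le_abs_self _
        _ ≤ d * (2 + 3 * M) :=
          mul_le_mul hpq ((abs_add_le p q).trans (by linarith)) (abs_nonneg _) hd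
    have h' : r * (2 + 3 * M) ≤ 3 * (M * (1 + M)) := by nlinarith
    calc r * (1 + r) / (M * (1 + M)) * (p ^ 2 - q ^ 2)
        ≤ r * (1 + r) / (M * (1 + M)) * (d * (2 + 3 * M)) := by gcongr
      _ = (1 + r) * d * (r * (2 + 3 * M)) / (M * (1 + M)) := by ring
      _ ≤ (1 + r) * d * (3 * (M * (1 + M))) / (M * (1 + M)) := by gcongr
      _ = 3 * (1 + r) * d := by field_simp
  have weight : (r * (1 + r) / (M * (1 + M)) - r * (1 + r) / (N * (1 + N))) * q ^ 2 ≤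
      3 * (1 + r) ^ 2 / r * d := by
    have h : q ^ 2 ≤ (1 + N) ^ 2 := sq_le_sq' (abs_le.mp hq).1 (abs_le.mp hq).2
    have h' : r * (1 + N) ≤ (1 + r) * N := by linarith
    calc (r * (1 + r) / (M * (1 + M)) - r * (1 + r) / (N * (1 + N))) * q ^ 2
        = (N - M) * (r * (1 + r) * (1 + N + M) / (M * (1 + M) * N * (1 + N)) * q ^ 2) := by
          field_simp
          ring
      _ ≤ d * (r * (1 + r) * (1 + N + M) / (M * (1 + M) * N * (1 + N)) * (1 + N) ^ 2) := by
          gcongr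
      _ = d * (1 + r) * (r * r * (1 + N) * (1 + N + M)) / (r * (M * (1 + M) * N)) := by
          field_simp
      _ ≤ d * (1 + r) * (M * ((1 + r) * N) * (3 * (1 + M))) / (r * (M * (1 + M) * N)) := by
          rw [mul_assoc r r (1 + N)]
          gcongr
          linarith
      _ = 3 * (1 + r) ^ 2 / r * d := by
          field_simp
  linarith

theorem abs_inner_sub_le {E : Type*} [NormedAddCommGroup E] [InnerProductSpace ℝ E]
    {φ y : E} {a : ℝ} (hφ : ‖φ‖ ≤ 1) (ha : |a| ≤ 1) : |⟪φ, y⟫ - a| ≤ 1 + ‖y‖ := by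
  have h : |⟪φ, y⟫| ≤ ‖y‖ :=
    (abs_real_inner_le_norm φ y).trans (mul_le_of_le_one_left (norm_nonneg y) hφ)
  linarith [abs_sub ⟪φ, y⟫ a]

/-- For a fixed `φ` in the unit ball, the stable loss is Lipschitz in the query point at scales
below the stable radius. -/
theorem stableLoss_sub_le {n : ℕ} {c : ℝ} (hc : 0 < c) {X : Finset (EuclideanSpace ℝ (Fin n))}
    (hX : X.Nonempty) {f : EuclideanSpace ℝ (Fin n) → ℝ} (hf : ∀ x, |f x| ≤ 1)
    {φ v w : EuclideanSpace ℝ (Fin n)} {d : ℝ} (hd : 0 ≤ d) (hdr : d ≤ stableRadius c)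
    (hvw : ‖v - w‖ ≤ d) (hφ : ‖φ‖ ≤ 1) :
    stableLoss c φ v X f - stableLoss c φ w X f ≤
      (3 * (1 + stableRadius c) + 3 * (1 + stableRadius c) ^ 2 / stableRadius c) * d := by
  have hcard : (0 : ℝ) < X.card := by exact_mod_cast hX.card_pos
  unfold stableLoss
  rw [← mul_sub, ← Finset.sum_sub_distrib, one_div_mul_eq_div, div_le_iff₀ hcard,
    mul_comm _ (X.card : ℝ), ← nsmul_eq_mul]
  refine Finset.sum_le_card_nsmul _ _ _ fun x _ => ?_
  rw [stableWeight_eq hc, stableWeight_eq hc]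
  refine weighted_sq_sub_le (stableRadius_pos hc) (le_max_right _ _) (le_max_right _ _) hd hdr
    ?_ ?_ ?_ ?_
  · refine (abs_max_sub_max_le_abs _ _ _).trans ((abs_norm_sub_norm_le _ _).trans ?_)
    rwa [sub_sub_sub_cancel_left]
  · rw [sub_sub_sub_cancel_right, ← inner_sub_right, sub_sub_sub_cancel_left]
    calc |⟪φ, w - v⟫| ≤ ‖φ‖ * ‖w - v‖ := abs_real_inner_le_norm _ _
      _ ≤ 1 * d := by rw [norm_sub_rev w v]; gcongr
      _ = d := one_mul d
  · exact (abs_inner_sub_le hφ (hf x)).trans (by gcongr; exact le_max_left _ _)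
  · exact (abs_inner_sub_le hφ (hf x)).trans (by gcongr; exact le_max_left _ _)

/-- consistent explanations in small regions. For every `c > 0` there is a
constant `K > 0` depending only on `c` such that if `‖v − z‖ ≤ d ≤ r` and `φ_z`, `φ_v`
minimize the stable local loss at `z` resp. `v` over the closed unit ball, then
`L(φ_z, v, X, f) − L(φ_v, v, X, f) ≤ K·d`. -/
theorem consistent_explanations_in_small_regions (c : ℝ) (hc : 0 < c) :
    ∃ K : ℝ, 0 < K ∧
      ∀ (n : ℕ), 1 ≤ n →
        ∀ X : Finset (EuclideanSpace ℝ (Fin n)), X.Nonempty →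
          ∀ f : EuclideanSpace ℝ (Fin n) → ℝ, (∀ x, |f x| ≤ 1) →
            ∀ z v φz φv : EuclideanSpace ℝ (Fin n), ∀ d : ℝ,
              0 ≤ d → d ≤ stableRadius c → ‖v - z‖ ≤ d →
              φz ∈ Metric.closedBall (0 : EuclideanSpace ℝ (Fin n)) 1 →
              IsMinOn (fun φ => stableLoss c φ z X f)
                (Metric.closedBall (0 : EuclideanSpace ℝ (Fin n)) 1) φz →
              φv ∈ Metric.closedBall (0 : EuclideanSpace ℝ (Fin n)) 1 →
              IsMinOn (fun φ => stableLoss c φ v X f)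
                (Metric.closedBall (0 : EuclideanSpace ℝ (Fin n)) 1) φv →
              stableLoss c φz v X f - stableLoss c φv v X f ≤ K * d := by
  have hr := stableRadius_pos hc
  refine ⟨2 * (3 * (1 + stableRadius c) + 3 * (1 + stableRadius c) ^ 2 / stableRadius c),
    by positivity, ?_⟩
  intro n _ X hX f hf z v φz φv d hd hdr hvz hφz hminz hφv _
  have hz := stableLoss_sub_le hc hX hf hd hdr hvz (mem_closedBall_zero_iff.mp hφz)
  have hv := stableLoss_sub_le hc hX hf hd hdr (norm_sub_rev v z ▸ hvz)
    (mem_closedBall_zero_iff.mp hφv)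
  have hmin : stableLoss c φz z X f ≤ stableLoss c φv z X f := hminz hφv
  linarith
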